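/- Let G be a graph with girth g and consider the binary code whose coordinates are the edges of G and whose parity checks are, for each vertex v, the sum of the code symbols on edges incident to v. This code can sequentially recover any pattern of at most g−1 erased edge-symbols, each repair using a parity check of weight at most Δ(G), where Δ(G) is the maximum degree. -/

import Mathlib

open Finset

theorem exists_leaf_edge {V : Type*} [Fintype V] (H : SimpleGraph V) (hH : H.IsAcyclic)
    {a b : V} (hab : H.Adj a b) : ∃ u w : V, H.Adj u w ∧ ∀ x, H.Adj u x → x = w := by
  have : Nonempty V := ⟨a⟩
  obtain ⟨u, v, p, hp, hmax⟩ := SimpleGraph.Walk.exists_isPath_forall_isPath_length_le_length H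
  have hnil : ¬ p.Nil := by
    intro hn
    have h1 := hmax a b (SimpleGraph.Walk.cons hab SimpleGraph.Walk.nil) (by simp [hab.ne])
    have h2 := SimpleGraph.Walk.nil_iff_length_eq.mp hn
    simp at h1
    omega
  refine ⟨u, p.snd, p.adj_snd hnil, fun x hx => ?_⟩
  apply hH.eq_snd_of_adj_start hp hx
  by_contra hns
  have h1 := hmax _ _ (SimpleGraph.Walk.cons hx.symm p) (hp.cons hns)
  simp at h1

theorem recovery_of_acyclic {V : Type*} [Fintype V] [DecidableEq V] (n : ℕ) :
    ∀ S : Finset (Sym2 V), S.card = n → (∀ e ∈ S, ¬ e.IsDiag) →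
      (SimpleGraph.fromEdgeSet (S : Set (Sym2 V))).IsAcyclic →
      ∃ σ : List (Sym2 V), σ.Nodup ∧ σ.toFinset = S ∧
        ∀ j : Fin σ.length, ∃ v : V, v ∈ σ.get j ∧
          ∀ j' : Fin σ.length, (j : ℕ) < (j' : ℕ) → v ∉ σ.get j' := by
  induction n with
  | zero =>
    intro S hS _ _
    refine ⟨[], by simp, by simp [Finset.card_eq_zero.mp hS], fun j => j.elim0⟩
  | succ n ih =>
    intro S hS hd hac
    obtain ⟨e, he⟩ : S.Nonempty := Finset.card_pos.mp (by omega)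
    induction e with | _ a b
    have hab : a ≠ b := by simpa using hd _ he
    obtain ⟨u, w, huw, hu⟩ := exists_leaf_edge _ hac (a := a) (b := b) (by simp [he, hab])
    have huwS : s(u, w) ∈ S := by
      have := (SimpleGraph.fromEdgeSet_adj _).mp huw
      exact_mod_cast this.1
    have hleaf : ∀ e ∈ S, u ∈ e → e = s(u, w) := by
      intro e heS hue
      obtain ⟨x, rfl⟩ := hue
      have hux : u ≠ x := by simpa using hd _ heS
      rw [hu x (by simp [heS, hux])]
    obtain ⟨σ, h1, h2, h3⟩ := ih (S.erase s(u, w)) (by rw [Finset.card_erase_of_mem huwS]; omega)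
      (fun e h => hd e (Finset.mem_of_mem_erase h))
      (hac.anti (SimpleGraph.fromEdgeSet_mono (by
        exact_mod_cast Finset.erase_subset _ _)))
    have hmem : ∀ e, e ∈ σ ↔ e ∈ S.erase s(u, w) := by
      intro e; rw [← h2, List.mem_toFinset]
    refine ⟨s(u, w) :: σ, ?_, ?_, ?_⟩
    · rw [List.nodup_cons]
      exact ⟨by simp [hmem], h1⟩
    · rw [List.toFinset_cons, h2, Finset.insert_erase huwS]
    · rintro ⟨j, hj⟩
      cases j with
      | zero =>
        refine ⟨u, by simp, ?_⟩
        rintro ⟨k, hk⟩ hlt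
        cases k with
        | zero => simp at hlt
        | succ k =>
          simp only [List.length_cons, Nat.add_lt_add_iff_right] at hk
          intro hmu
          have h4 : σ[k] ∈ S.erase s(u, w) := (hmem _).mp (List.getElem_mem hk)
          exact (Finset.mem_erase.mp h4).1 (hleaf _ (Finset.mem_of_mem_erase h4) (by simpa using hmu))
      | succ j =>
        simp only [List.length_cons, Nat.add_lt_add_iff_right] at hj
        obtain ⟨v, hv, hv'⟩ := h3 ⟨j, hj⟩
        refine ⟨v, by simpa using hv, ?_⟩
        rintro ⟨k, hk⟩ hlt
        cases k with
        | zero => simp at hlt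
        | succ k =>
          simp only [List.length_cons, Nat.add_lt_add_iff_right] at hk
          have := hv' ⟨k, hk⟩ (by simpa using hlt)
          simpa using this

/-- Edge-symbol code of a graph: parity checks are the vertices (each check sums the symbols
on the incident edges). Any set `S` of fewer than `girth(G)` erased edge-symbols can be
sequentially recovered: there is an ordering of `S` such that each erased edge is repaired
by the parity check of one of its endpoints, a check of weight at most `Δ(G)` whose support
contains no later erased edge. -/
theorem graph_code_sequential_recovery {V : Type*} [Fintype V] [DecidableEq V]
    (G : SimpleGraph V) [DecidableRel G.Adj]
    (S : Finset (Sym2 V)) (hS : ↑S ⊆ G.edgeSet)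
    (hcard : (S.card : ℕ∞) < G.girth) :
    ∃ σ : List (Sym2 V), σ.Nodup ∧ σ.toFinset = S ∧
      ∀ j : Fin σ.length, ∃ v : V, v ∈ σ.get j ∧ G.degree v ≤ G.maxDegree ∧
        ∀ j' : Fin σ.length, (j : ℕ) < (j' : ℕ) → v ∉ σ.get j' := by
  have hd : ∀ e ∈ S, ¬ e.IsDiag := fun e he => G.not_isDiag_of_mem_edgeSet (hS he)
  have hle : SimpleGraph.fromEdgeSet (S : Set (Sym2 V)) ≤ G := by
    intro a b h
    exact hS ((SimpleGraph.fromEdgeSet_adj _).mp h).1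
  have hac : (SimpleGraph.fromEdgeSet (S : Set (Sym2 V))).IsAcyclic := by
    intro a c hc
    have h1 : G.girth ≤ (c.mapLe hle).length := SimpleGraph.girth_le_length (hc.mapLe hle)
    have h2 : c.edges.toFinset ⊆ S := by
      intro e he
      have := c.edges_subset_edgeSet (List.mem_toFinset.mp he)
      rw [SimpleGraph.edgeSet_fromEdgeSet] at this
      exact_mod_cast this.1
    have h3 := Finset.card_le_card h2
    rw [List.toFinset_card_of_nodup hc.edges_nodup, SimpleGraph.Walk.length_edges] at h3
    have h4 : S.card < G.girth := by exact_mod_cast hcard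
    simp at h1
    omega
  obtain ⟨σ, h1, h2, h3⟩ := recovery_of_acyclic _ S rfl hd hac
  refine ⟨σ, h1, h2, fun j => ?_⟩
  obtain ⟨v, hv, hv'⟩ := h3 j
  exact ⟨v, hv, G.degree_le_maxDegree v, hv'⟩
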